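/- Let U ≠ ∅ be a connected open set in ℝ^d, d ≥ 2, let A ⊆ U be relatively closed in U, let V be a bounded open subset of U, and let E be a closed set contained in A ∩ V. Then H_{V\A} 1_{∂V} ≤ 1 − H_{V\E} 1_E on V \ A. -/

import Mathlib

open Metric MeasureTheory Filter Set Topology
open scoped ENNReal

noncomputable section

/-- Points of `ℝ^d`. -/
abbrev Pt (d : ℕ) : Type := EuclideanSpace ℝ (Fin d)

/-- A function `u` is superharmonic on an open set `W ⊆ ℝ^d` if it is lower semicontinuous
on `W` and satisfies the super-mean-value inequality on balls whose closure lies in `W`. -/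
def IsSuperharmonicOn {d : ℕ} (W : Set (Pt d)) (u : Pt d → ℝ) : Prop :=
  LowerSemicontinuousOn u W ∧
    ∀ x ∈ W, ∀ r : ℝ, 0 < r → closedBall x r ⊆ W →
      ⨍ y in ball x r, u y ≤ u x

/-- The upper (Perron–Wiener–Brelot) class for the generalized Dirichlet problem on `W`
with boundary data `f`: superharmonic functions on `W`, bounded below, whose `liminf` at every
(finite) boundary point of `W` dominates `f`, and which are asymptotically nonnegative at
infinity (a vacuous condition when `W` is bounded). -/
def InUpperClass {d : ℕ} (W : Set (Pt d)) (f u : Pt d → ℝ) : Prop :=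
  IsSuperharmonicOn W u ∧ BddBelow (u '' W) ∧
    (∀ z ∈ frontier W, f z ≤ Filter.liminf u (𝓝[W] z)) ∧
    (∀ ε : ℝ, 0 < ε → ∃ K : Set (Pt d), IsCompact K ∧ ∀ y ∈ W, y ∉ K → -ε ≤ u y)

open Classical in
/-- `HSol W f` is the generalized (PWB) Dirichlet solution `H_W f` on `W`, extended by `f`
off `W`. -/
def HSol {d : ℕ} (W : Set (Pt d)) (f : Pt d → ℝ) (x : Pt d) : ℝ :=
  if x ∈ W then sInf ((fun u => u x) '' {u | InUpperClass W f u}) else f x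

/-- A relatively closed set `A ⊆ U` is unavoidable in `U` if `H_{U\A} 1_A = 1` on `U`. -/
def Unavoidable {d : ℕ} (U A : Set (Pt d)) : Prop :=
  ∀ z ∈ U, HSol (U \ A) (A.indicator 1) z = 1

/-- `U \ ⋃_{x ∈ X} B̄(x, rr x)` is a champagne subregion of `U`:  `X` is a countable set in `U`
with no accumulation point in `U`, the radii belong to `(0,1)`, the bubbles are pairwise
disjoint, `sup_{x ∈ X} rr x / dist(x, ∂U) < 1`, and `rr x → 0` as `x → ∞` if `U` is unbounded. -/
def IsChampagne {d : ℕ} (U X : Set (Pt d)) (rr : Pt d → ℝ) : Prop :=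
  X ⊆ U ∧ X.Countable ∧ (∀ z ∈ U, ¬ AccPt z (𝓟 X)) ∧
    (∀ x ∈ X, rr x ∈ Set.Ioo (0 : ℝ) 1) ∧
    X.Pairwise (fun x y => Disjoint (closedBall x (rr x)) (closedBall y (rr y))) ∧
    (∃ c : ℝ≥0∞, c < 1 ∧ ∀ x ∈ X, ENNReal.ofReal (rr x) ≤ c * EMetric.infEdist x Uᶜ) ∧
    (¬ Bornology.IsBounded U → ∀ ε : ℝ, 0 < ε → ∃ R : ℝ, ∀ x ∈ X, R ≤ ‖x‖ → rr x < ε)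

/-- The union of the bubbles `B̄(x, rr x)`, `x ∈ X`. -/
def Bubbles {d : ℕ} (X : Set (Pt d)) (rr : Pt d → ℝ) : Set (Pt d) :=
  ⋃ x ∈ X, closedBall x (rr x)

/-- `N(t) = log(1/t)` if `d = 2`, `N(t) = t^{2-d}` if `d ≥ 3`; `(x,y) ↦ N(|x-y|)` is the
global Green function. -/
def NGreen (d : ℕ) (t : ℝ) : ℝ := if d = 2 then Real.log (1 / t) else t ^ ((2 : ℝ) - d)

/-- The capacity function `φ = 1/N`. -/
def phiCap (d : ℕ) (t : ℝ) : ℝ := (NGreen d t)⁻¹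

end

namespace HelperPWB

noncomputable section

open scoped Pointwise Manifold ContDiff


/-- Coordinate unit vector. -/
def ee {d : ℕ} (i : Fin d) : Pt d := EuclideanSpace.single i (1 : ℝ)

/-- Laplacian as a sum of pure second derivatives. -/
def lapl {d : ℕ} (g : Pt d → ℝ) (x : Pt d) : ℝ :=
  ∑ i, fderiv ℝ (fun y => fderiv ℝ g y (ee i)) x (ee i)

/-- Mean over a ball. -/
def av {d : ℕ} (u : Pt d → ℝ) (x : Pt d) (r : ℝ) : ℝ := ⨍ y in ball x r, u y

/-- Rescaled integral over a ball. -/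
def phi {d : ℕ} (u : Pt d → ℝ) (x : Pt d) (t : ℝ) : ℝ :=
  ∫ y in ball (0 : Pt d) 1, u (x + t • y)

def vb (d : ℕ) : ℝ := volume.real (ball (0 : Pt d) 1)

lemma vb_pos (d : ℕ) : 0 < vb d := by
  unfold vb
  exact ENNReal.toReal_pos (measure_ball_pos _ _ one_pos).ne' measure_ball_lt_top.ne

lemma setInt_ball {d : ℕ} (u : Pt d → ℝ) (x : Pt d) {r : ℝ} (hr : 0 < r) :
    ∫ y in ball x r, u y = r ^ d * phi u x r := by
  have h1 := Measure.setIntegral_comp_smul_of_pos (volume : Measure (Pt d))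
    (fun y => u (x + y)) (ball 0 1) hr
  have h2 : r • ball (0 : Pt d) 1 = ball 0 r := by
    rw [smul_unitBall hr.ne', Real.norm_of_nonneg hr.le]
  have h3 : ∫ y in ball (0 : Pt d) r, u (x + y) = ∫ y in ball x r, u y := by
    have := (measurePreserving_add_left (volume : Measure (Pt d)) x).setIntegral_preimage_emb
      (measurableEmbedding_addLeft x) u (ball x r)
    rw [← this]
    congr 2
    ext y
    simp [dist_eq_norm]
  rw [h2, h3] at h1
  unfold phi
  rw [h1, finrank_euclideanSpace_fin, smul_eq_mul, mul_inv_cancel_left₀ (pow_pos hr d).ne']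

lemma vol_ball {d : ℕ} (x : Pt d) {r : ℝ} (hr : 0 < r) :
    volume.real (ball x r) = r ^ d * vb d := by
  have := setInt_ball (fun _ => (1 : ℝ)) x hr
  simpa [phi, vb] using this

lemma av_eq {d : ℕ} (u : Pt d → ℝ) (x : Pt d) {r : ℝ} (hr : 0 < r) :
    av u x r = (vb d)⁻¹ * phi u x r := by
  unfold av
  rw [setAverage_eq, vol_ball x hr, setInt_ball u x hr, smul_eq_mul]
  have := (pow_pos hr d).ne'
  have := (vb_pos d).ne'
  field_simp

def ww {d : ℕ} (y : Pt d) : ℝ := (1 - (min ‖y‖ 1) ^ 2) / 2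

lemma ww_nonneg {d : ℕ} (y : Pt d) : 0 ≤ ww y := by
  unfold ww
  have h0 : 0 ≤ min ‖y‖ 1 := le_min (norm_nonneg _) zero_le_one
  have h1 : min ‖y‖ 1 ≤ 1 := min_le_right _ _
  nlinarith

lemma ww_zero {d : ℕ} (y : Pt d) (hy : y ∉ ball (0 : Pt d) 1) : ww y = 0 := by
  unfold ww
  have : 1 ≤ ‖y‖ := by simpa using hy
  rw [min_eq_right this]; norm_num

lemma ww_lip {d : ℕ} : LipschitzWith 1 (ww : Pt d → ℝ) := by
  refine LipschitzWith.of_dist_le_mul fun x y => ?_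
  have hx0 : 0 ≤ min ‖x‖ 1 := le_min (norm_nonneg _) zero_le_one
  have hx1 : min ‖x‖ 1 ≤ 1 := min_le_right _ _
  have hy0 : 0 ≤ min ‖y‖ 1 := le_min (norm_nonneg _) zero_le_one
  have hy1 : min ‖y‖ 1 ≤ 1 := min_le_right _ _
  have h1 : |min ‖x‖ 1 - min ‖y‖ 1| ≤ dist x y := by
    have := abs_min_sub_min_le_max ‖x‖ 1 ‖y‖ 1
    refine this.trans ?_
    simp only [sub_self, abs_zero, abs_nonneg, sup_of_le_left]
    rw [dist_eq_norm]
    exact abs_norm_sub_norm_le x y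
  rw [Real.dist_eq]
  unfold ww
  have : (1 - (min ‖x‖ 1) ^ 2) / 2 - (1 - (min ‖y‖ 1) ^ 2) / 2
    = -((min ‖x‖ 1 + min ‖y‖ 1) / 2) * (min ‖x‖ 1 - min ‖y‖ 1) := by ring
  rw [this, abs_mul, abs_neg, abs_of_nonneg (by positivity)]
  calc _ ≤ 1 * |min ‖x‖ 1 - min ‖y‖ 1| := by gcongr; linarith
    _ ≤ _ := by simpa using h1

lemma ww_line {d : ℕ} (i : Fin d) (y : Pt d) (hy : y ∉ sphere (0 : Pt d) 1) :
    lineDeriv ℝ ww y (ee i) = (ball (0 : Pt d) 1).indicator (fun y => - y i) y := by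
  by_cases h : y ∈ ball (0 : Pt d) 1
  · rw [indicator_of_mem h]
    have hev : ww =ᶠ[𝓝 y] fun z => (1 - ‖z‖ ^ 2) / 2 := by
      filter_upwards [isOpen_ball.mem_nhds h] with z hz
      unfold ww
      rw [min_eq_left (by simpa using (mem_ball_zero_iff.1 hz).le)]
    have h1 : HasFDerivAt (fun z : Pt d => ‖z‖ ^ 2) (2 • (innerSL ℝ y)) y :=
      (hasStrictFDerivAt_norm_sq y).hasFDerivAt
    have h2 := ((h1.const_sub 1).mul_const (1/2 : ℝ))
    have h3 : HasFDerivAt ww _ y := (h2.congr_of_eventuallyEq (by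
      filter_upwards [hev] with z hz; rw [hz]; ring))
    rw [h3.hasLineDerivAt (ee i) |>.lineDeriv]
    simp [ee, EuclideanSpace.inner_single_right]
  · rw [indicator_of_notMem h]
    have h' : 1 < ‖y‖ := by
      have h1 : ‖y‖ ≠ 1 := by simpa using hy
      have h2 : 1 ≤ ‖y‖ := by simpa using h
      exact lt_of_le_of_ne h2 h1.symm
    have hev : ww =ᶠ[𝓝 y] fun _ => (0 : ℝ) := by
      filter_upwards [(isOpen_lt continuous_const continuous_norm).mem_nhds h'] with z hz
      exact ww_zero z (by simpa using le_of_lt hz)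
    have h3 : HasFDerivAt ww (0 : Pt d →L[ℝ] ℝ) y :=
      (hasFDerivAt_const (0:ℝ) y).congr_of_eventuallyEq hev
    rw [h3.hasLineDerivAt (ee i) |>.lineDeriv]
    simp

lemma clm_coord_sum {d : ℕ} (L : Pt d →L[ℝ] ℝ) (y : Pt d) : L y = ∑ i, y i * L (ee i) := by
  have : y = ∑ i, y i • (ee i : Pt d) := by
    ext j
    simp [ee, Finset.sum_apply, Pi.single_apply]
  conv_lhs => rw [this]
  simp

lemma contDiff_part {d : ℕ} {G : Pt d → ℝ} (hG : ContDiff ℝ 2 G) (v : Pt d) :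
    ContDiff ℝ 1 (fun y => fderiv ℝ G y v) :=
  (hG.fderiv_right (m := 1) (by norm_num)).clm_apply contDiff_const

lemma ibp {d : ℕ} (hd : 2 ≤ d) {G : Pt d → ℝ} (hG : ContDiff ℝ 2 G) (hc : HasCompactSupport G) :
    ∫ y in ball (0 : Pt d) 1, fderiv ℝ G y y = ∫ y in ball (0 : Pt d) 1, ww y * lapl G y := by
  have : Nonempty (Fin d) := ⟨⟨0, by omega⟩⟩
  have key : ∀ i : Fin d, ∫ y in ball (0 : Pt d) 1, y i * fderiv ℝ G y (ee i)
      = ∫ y in ball (0 : Pt d) 1, ww y * fderiv ℝ (fun y => fderiv ℝ G y (ee i)) y (ee i) := by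
    intro i
    have hgc : HasCompactSupport (fun y => fderiv ℝ G y (ee i)) := hc.fderiv_apply ℝ (ee i)
    obtain ⟨D, hD⟩ := ContDiff.lipschitzWith_of_hasCompactSupport hgc (contDiff_part hG (ee i))
      one_ne_zero
    have := LipschitzWith.integral_lineDeriv_mul_eq (μ := volume) ww_lip hD hgc (ee i)
    have hL : ∫ x, lineDeriv ℝ ww x (ee i) * fderiv ℝ G x (ee i)
        = - ∫ y in ball (0 : Pt d) 1, y i * fderiv ℝ G y (ee i) := by
      rw [← integral_neg, ← integral_indicator measurableSet_ball]
      apply integral_congr_ae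
      have hs : volume (sphere (0 : Pt d) 1) = 0 := Measure.addHaar_sphere _ _ _
      filter_upwards [compl_mem_ae_iff.2 hs] with y hy
      rw [ww_line i y hy]
      by_cases h : y ∈ ball (0 : Pt d) 1 <;> simp [h]
    have hR : ∫ x, lineDeriv ℝ (fun y => fderiv ℝ G y (ee i)) x (-(ee i)) * ww x
        = - ∫ y in ball (0 : Pt d) 1, ww y *
            fderiv ℝ (fun y => fderiv ℝ G y (ee i)) y (ee i) := by
      rw [← integral_neg, ← integral_indicator measurableSet_ball]
      congr 1
      ext y
      have h3 := ((contDiff_part hG (ee i)).differentiable one_ne_zero y).hasFDerivAt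
      rw [h3.hasLineDerivAt (-(ee i)) |>.lineDeriv]
      by_cases h : y ∈ ball (0 : Pt d) 1
      · simp [h]; ring
      · simp [h, ww_zero y h]
    rw [hL, hR] at this
    exact neg_injective this
  have hitg : ∀ f : Pt d → ℝ, Continuous f → IntegrableOn f (ball (0 : Pt d) 1) := fun f hf =>
    (hf.continuousOn.integrableOn_compact (isCompact_closedBall (0 : Pt d) 1)).mono_set
      ball_subset_closedBall
  have hco : ∀ i : Fin d, Continuous fun y => fderiv ℝ G y (ee i) := fun i =>
    (contDiff_part hG (ee i)).continuous
  have hco2 : ∀ i : Fin d, Continuous fun y =>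
      fderiv ℝ (fun y => fderiv ℝ G y (ee i)) y (ee i) := fun i =>
    ((contDiff_part hG (ee i)).continuous_fderiv one_ne_zero).clm_apply continuous_const
  have hco3 : ∀ i : Fin d, Continuous fun y : Pt d => y i := fun i => by fun_prop
  simp_rw [fun y => clm_coord_sum (fderiv ℝ G y) y, lapl, Finset.mul_sum]
  rw [integral_finsetSum _ fun i _ => hitg (fun y => y i * fderiv ℝ G y (ee i)) ((hco3 i).mul (hco i)),
    integral_finsetSum _ fun i _ => hitg (fun y => ww y * fderiv ℝ (fun y => fderiv ℝ G y (ee i)) y (ee i))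
      (ww_lip.continuous.mul (hco2 i))]
  exact Finset.sum_congr rfl fun i _ => key i

lemma lapl_scale {d : ℕ} {g : Pt d → ℝ} (hg : ContDiff ℝ 2 g) (x : Pt d) (t : ℝ) (y : Pt d) :
    lapl (fun y => g (x + t • y)) y = t ^ 2 * lapl g (x + t • y) := by
  have aux : ∀ (f : Pt d → ℝ), Differentiable ℝ f → ∀ y v, fderiv ℝ (fun y => f (x + t • y)) y v
      = t * fderiv ℝ f (x + t • y) v := by
    intro f hf y v
    have h1 : HasFDerivAt (fun y : Pt d => x + t • y) (t • ContinuousLinearMap.id ℝ (Pt d)) y :=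
      ((hasFDerivAt_id y).const_smul t).const_add x
    have := ((hf (x + t • y)).hasFDerivAt.comp y h1).fderiv
    rw [Function.comp_def] at this
    rw [this]; simp
  unfold lapl
  rw [Finset.mul_sum]
  refine Finset.sum_congr rfl fun i _ => ?_
  have e1 : (fun y => fderiv ℝ (fun y => g (x + t • y)) y (ee i))
      = fun y => (t • fun z => fderiv ℝ g z (ee i)) (x + t • y) := by
    ext y; rw [aux g (hg.differentiable two_ne_zero)]; rfl
  have hd1 := (contDiff_part hg (ee i)).differentiable one_ne_zero
  rw [e1, aux _ (hd1.const_smul t), fderiv_const_smul (hd1 _)]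
  simp; ring

lemma phi_hasDeriv {d : ℕ} {g : Pt d → ℝ} (hg : ContDiff ℝ 2 g) (x : Pt d) (t : ℝ) :
    HasDerivAt (phi g x) (∫ y in ball (0 : Pt d) 1, fderiv ℝ g (x + t • y) y) t := by
  have hcf : Continuous (fderiv ℝ g) := hg.continuous_fderiv two_ne_zero
  have hc' : Continuous fun p : ℝ × Pt d => fderiv ℝ g (x + p.1 • p.2) p.2 := by fun_prop
  obtain ⟨C, hC⟩ := ((isCompact_Icc (a := t - 1) (b := t + 1)).prod
    (isCompact_closedBall (0 : Pt d) 1)).exists_bound_of_continuousOn hc'.continuousOn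
  have hgc := hg.continuous
  have hitg : ∀ f : Pt d → ℝ, Continuous f → IntegrableOn f (ball (0 : Pt d) 1) := fun f hf =>
    (hf.continuousOn.integrableOn_compact (isCompact_closedBall (0 : Pt d) 1)).mono_set
      ball_subset_closedBall
  refine (hasDerivAt_integral_of_dominated_loc_of_deriv_le (bound := fun _ => C)
    (F := fun t y => g (x + t • y)) (F' := fun t y => fderiv ℝ g (x + t • y) y)
    (s := Icc (t - 1) (t + 1)) (Icc_mem_nhds (by linarith) (by linarith)) ?_ ?_ ?_ ?_ ?_ ?_).2
  · refine Eventually.of_forall fun s => (hitg _ (by fun_prop)).aestronglyMeasurable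
  · exact hitg _ (by fun_prop)
  · exact (hitg _ (by fun_prop)).aestronglyMeasurable
  · filter_upwards [ae_restrict_mem measurableSet_ball] with y hy s hs
    exact hC (s, y) ⟨hs, ball_subset_closedBall hy⟩
  · exact hitg _ continuous_const
  · refine Eventually.of_forall fun y s _ => ?_
    have h1 : HasDerivAt (fun s : ℝ => x + s • y) y s := by
      simpa using ((hasDerivAt_id s).smul_const y).const_add x
    exact ((hg.differentiable two_ne_zero _).hasFDerivAt.comp_hasDerivAt s h1)

lemma av_le_of_lapl_cs {d : ℕ} (hd : 2 ≤ d) {g : Pt d → ℝ} (hg : ContDiff ℝ 2 g)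
    (hc : HasCompactSupport g) (x : Pt d) {r : ℝ} (hr : 0 < r)
    (hl : ∀ y ∈ ball x r, lapl g y ≤ 0) : av g x r ≤ g x := by
  have hanti : AntitoneOn (phi g x) (Icc 0 r) := by
    apply antitoneOn_of_deriv_nonpos (convex_Icc 0 r)
    · exact fun t _ => (phi_hasDeriv hg x t).continuousAt.continuousWithinAt
    · exact fun t _ => (phi_hasDeriv hg x t).differentiableAt.differentiableWithinAt
    · intro t ht
      rw [interior_Icc] at ht
      rw [(phi_hasDeriv hg x t).deriv]
      have hG : ContDiff ℝ 2 (fun y => g (x + t • y)) := by fun_prop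
      have hGc : HasCompactSupport (fun y => g (x + t • y)) := by
        have := hc.comp_homeomorph ((Homeomorph.smulOfNeZero t ht.1.ne').trans
          (Homeomorph.addLeft x))
        exact this
      have h := ibp hd hG hGc
      have h1 : ∀ y, fderiv ℝ (fun y => g (x + t • y)) y y = t * fderiv ℝ g (x + t • y) y := by
        intro y
        have h1 : HasFDerivAt (fun y : Pt d => x + t • y) (t • ContinuousLinearMap.id ℝ (Pt d)) y :=
          ((hasFDerivAt_id y).const_smul t).const_add x
        have := ((hg.differentiable two_ne_zero (x + t • y)).hasFDerivAt.comp y h1).fderiv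
        rw [Function.comp_def] at this
        rw [this]; simp
      simp_rw [h1, lapl_scale hg] at h
      rw [integral_const_mul] at h
      have h2 : ∫ y in ball (0 : Pt d) 1, ww y * (t ^ 2 * lapl g (x + t • y)) ≤ 0 := by
        apply setIntegral_nonpos measurableSet_ball
        intro y hy
        have hy' : x + t • y ∈ ball x r := by
          rw [mem_ball_iff_norm]
          simp only [add_sub_cancel_left, norm_smul, Real.norm_of_nonneg ht.1.le]
          have := mem_ball_zero_iff.1 hy
          nlinarith [ht.1, ht.2, norm_nonneg y]
        exact mul_nonpos_of_nonneg_of_nonpos (ww_nonneg y)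
          (mul_nonpos_of_nonneg_of_nonpos (sq_nonneg t) (hl _ hy'))
      rw [← h] at h2
      by_contra hcon
      push Not at hcon
      exact absurd h2 (not_le.2 (mul_pos ht.1 hcon))
  have h := hanti ⟨le_rfl, hr.le⟩ ⟨hr.le, le_rfl⟩ hr.le
  rw [av_eq g x hr]
  have h0 : phi g x 0 = vb d * g x := by simp [phi, vb]
  rw [h0] at h
  rw [inv_mul_le_iff₀ (vb_pos d)]
  exact h

lemma lapl_congr {d : ℕ} {f g : Pt d → ℝ} {x : Pt d} (h : f =ᶠ[𝓝 x] g) : lapl f x = lapl g x := by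
  unfold lapl
  refine Finset.sum_congr rfl fun i _ => ?_
  have : (fun y => fderiv ℝ f y (ee i)) =ᶠ[𝓝 x] fun y => fderiv ℝ g y (ee i) := by
    filter_upwards [h.fderiv (𝕜 := ℝ)] with y hy
    rw [hy]
  rw [this.fderiv_eq]

lemma av_congr {d : ℕ} {f g : Pt d → ℝ} {x : Pt d} {r : ℝ} (h : ∀ y ∈ ball x r, f y = g y) :
    av f x r = av g x r := by
  unfold av
  rw [setAverage_eq, setAverage_eq, setIntegral_congr_fun measurableSet_ball h]

lemma av_le_of_lapl {d : ℕ} (hd : 2 ≤ d) {g : Pt d → ℝ} (hg : ContDiff ℝ 2 g)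
    (x : Pt d) {r : ℝ} (hr : 0 < r) (hl : ∀ y ∈ ball x r, lapl g y ≤ 0) : av g x r ≤ g x := by
  let χ : ContDiffBump x := ⟨r, r + 1, hr, by linarith⟩
  have h1 : ∀ y ∈ ball x r, (fun z => χ z * g z) =ᶠ[𝓝 y] g := by
    intro y hy
    filter_upwards [isOpen_ball.mem_nhds hy] with z hz
    rw [χ.one_of_mem_closedBall (ball_subset_closedBall hz), one_mul]
  have := av_le_of_lapl_cs hd (g := fun z => χ z * g z) (χ.contDiff.mul hg)
    (χ.hasCompactSupport.mul_right) x hr (fun y hy => by rw [lapl_congr (h1 y hy)]; exact hl y hy)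
  rwa [av_congr (fun y hy => (h1 y hy).eq_of_nhds),
    (h1 x (mem_ball_self hr)).eq_of_nhds] at this




lemma intOn_ball {d : ℕ} {u : Pt d → ℝ} (hu : Continuous u) (x : Pt d) (r : ℝ) :
    IntegrableOn u (ball x r) :=
  (hu.continuousOn.integrableOn_compact (isCompact_closedBall x r)).mono_set
    ball_subset_closedBall

lemma intOn_ball' {d : ℕ} {u : Pt d → ℝ} {x : Pt d} {r : ℝ} (hu : ContinuousOn u (closedBall x r)) :
    IntegrableOn u (ball x r) :=
  (hu.integrableOn_compact (isCompact_closedBall x r)).mono_set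
    ball_subset_closedBall

lemma volr_pos {d : ℕ} (x : Pt d) {r : ℝ} (hr : 0 < r) : 0 < volume.real (ball x r) := by
  rw [vol_ball x hr]
  exact mul_pos (pow_pos hr d) (vb_pos d)

lemma av_def {d : ℕ} (u : Pt d → ℝ) (x : Pt d) (r : ℝ) :
    av u x r = (volume.real (ball x r))⁻¹ * ∫ y in ball x r, u y := by
  unfold av; rw [setAverage_eq, smul_eq_mul]

lemma av_mono {d : ℕ} {u v : Pt d → ℝ} {x : Pt d} {r : ℝ} (hu : IntegrableOn u (ball x r))
    (hv : IntegrableOn v (ball x r)) (h : ∀ y ∈ ball x r, u y ≤ v y) : av u x r ≤ av v x r := by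
  rw [av_def, av_def]
  exact mul_le_mul_of_nonneg_left (setIntegral_mono_on hu hv measurableSet_ball h)
    (inv_nonneg.2 measureReal_nonneg)

lemma av_sub {d : ℕ} {u v : Pt d → ℝ} {x : Pt d} {r : ℝ} (hu : IntegrableOn u (ball x r))
    (hv : IntegrableOn v (ball x r)) :
    av (fun y => u y - v y) x r = av u x r - av v x r := by
  rw [av_def, av_def, av_def, integral_sub hu hv, mul_sub]

lemma av_add_const {d : ℕ} {u : Pt d → ℝ} {x : Pt d} {r : ℝ} (hr : 0 < r)
    (hu : IntegrableOn u (ball x r)) (c : ℝ) :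
    av (fun y => u y + c) x r = av u x r + c := by
  have hc : IntegrableOn (fun _ : Pt d => c) (ball x r) := intOn_ball continuous_const x r
  rw [av_def, av_def, integral_add hu hc, mul_add]
  have := (volr_pos x hr).ne'
  simp [setIntegral_const]
  field_simp

lemma av_neg {d : ℕ} (u : Pt d → ℝ) (x : Pt d) (r : ℝ) :
    av (fun y => - u y) x r = - av u x r := by
  rw [av_def, av_def, integral_neg, mul_neg]

/-- Local super-mean-value property at a point. -/
def LSup {d : ℕ} (u : Pt d → ℝ) (x : Pt d) : Prop := ∀ᶠ r in 𝓝[>] (0 : ℝ), av u x r ≤ u x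

lemma min_principle {d : ℕ} (hd : 2 ≤ d) {W : Set (Pt d)} (hb : Bornology.IsBounded W)
    (hWo : IsOpen W) {u : Pt d → ℝ} (hu : ContinuousOn u (closure W))
    (hs : ∀ x ∈ W, LSup u x) {c : ℝ} (hc : ∀ x ∈ frontier W, c ≤ u x) : ∀ x ∈ W, c ≤ u x := by
  intro x0 hx0
  by_contra hlt
  push Not at hlt
  have hK : IsCompact (closure W) := hb.isCompact_closure
  obtain ⟨xm, hxm, hmin⟩ := hK.exists_isMinOn ⟨x0, subset_closure hx0⟩ hu
  have hmc : u xm < c := lt_of_le_of_lt (hmin (subset_closure hx0)) hlt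
  set K0 := closure W ∩ u ⁻¹' {u xm} with hK0
  have hK0c : IsCompact K0 := hK.of_isClosed_subset
    (hu.preimage_isClosed_of_isClosed isClosed_closure isClosed_singleton) inter_subset_left
  let i0 : Fin d := ⟨0, by omega⟩
  obtain ⟨x, hx, hmax⟩ := hK0c.exists_isMaxOn ⟨xm, hxm, rfl⟩
    (f := fun x : Pt d => x i0) (by fun_prop)
  have hux : u x = u xm := hx.2
  have hxW : x ∈ W := by
    by_contra hn
    have : x ∈ frontier W := by rw [frontier, hWo.interior_eq]; exact ⟨hx.1, hn⟩
    linarith [hc x this]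
  obtain ⟨R, hR, hRW⟩ := Metric.isOpen_iff.1 hWo x hxW
  have hsm : ∀ᶠ r in 𝓝[>] (0 : ℝ), r < R := by
    filter_upwards [Ioo_mem_nhdsGT hR] with r hr using hr.2
  obtain ⟨r, hr1, hr2, hr0⟩ := ((hs x hxW).and (hsm.and self_mem_nhdsWithin)).exists
  have hr0 : 0 < r := hr0
  have hcb : closedBall x r ⊆ W := (closedBall_subset_ball hr2).trans hRW
  have hcont : ContinuousOn u (closedBall x r) := hu.mono (hcb.trans subset_closure)
  have hitg := intOn_ball' hcont
  have hge : ∀ y ∈ ball x r, 0 ≤ u y - u xm := fun y hy =>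
    sub_nonneg.2 (hmin (subset_closure (hcb (ball_subset_closedBall hy))))
  have hitg2 : IntegrableOn (fun y => u y - u xm) (ball x r) :=
    hitg.sub (intOn_ball continuous_const x r)
  have hzero : ∫ y in ball x r, (u y - u xm) = 0 := by
    refine le_antisymm ?_ (setIntegral_nonneg measurableSet_ball hge)
    have h1 := av_add_const hr0 hitg (-(u xm))
    rw [av_def] at h1
    have h2 : (volume.real (ball x r))⁻¹ * ∫ y in ball x r, (u y + -(u xm)) ≤ 0 := by
      rw [h1]; linarith
    have h3 := inv_pos.2 (volr_pos x hr0)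
    simp only [← sub_eq_add_neg] at h2
    by_contra hcon
    push Not at hcon
    exact absurd h2 (not_le.2 (mul_pos h3 hcon))
  rw [setIntegral_eq_zero_iff_of_nonneg_ae
    ((ae_restrict_iff' measurableSet_ball).2 (Eventually.of_forall hge)) hitg2] at hzero
  have heq : EqOn (fun y => u y - u xm) 0 (ball x r) :=
    Measure.eqOn_open_of_ae_eq hzero isOpen_ball
      ((hcont.mono ball_subset_closedBall).sub continuousOn_const) continuousOn_const
  have hy : x + (r / 2) • ee i0 ∈ ball x r := by
    rw [mem_ball_iff_norm]
    simp only [add_sub_cancel_left, norm_smul, ee, EuclideanSpace.norm_single]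
    rw [Real.norm_of_nonneg (by positivity)]
    simp; linarith
  have h1 := heq hy
  have h2 : x + (r / 2) • ee i0 ∈ K0 :=
    ⟨subset_closure (hcb (ball_subset_closedBall hy)), by simpa [sub_eq_zero] using h1⟩
  have h3 := hmax h2
  simp [ee] at h3
  linarith

/-- Evaluation of polynomials on Euclidean space. -/
def ev {d : ℕ} (p : MvPolynomial (Fin d) ℝ) (x : Pt d) : ℝ := MvPolynomial.eval x.ofLp p

lemma ev_contDiff {d : ℕ} (p : MvPolynomial (Fin d) ℝ) {n : ℕ∞} : ContDiff ℝ n (ev p) := by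
  induction p using MvPolynomial.induction_on with
  | C a =>
    have : ev (MvPolynomial.C a) = fun _ : Pt d => a := by ext; simp [ev]
    rw [this]; exact contDiff_const
  | add p q hp hq =>
    have : ev (p + q) = fun x => ev p x + ev q x := by ext; simp [ev]
    rw [this]; exact hp.add hq
  | mul_X p i hp =>
    have : ev (p * MvPolynomial.X i) = fun x => ev p x * x i := by ext; simp [ev]
    rw [this]
    exact hp.mul (by fun_prop)

lemma ev_fderiv {d : ℕ} (p : MvPolynomial (Fin d) ℝ) (y : Pt d) (i : Fin d) :
    fderiv ℝ (ev p) y (ee i) = ev (MvPolynomial.pderiv i p) y := by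
  have hdiff : ∀ p : MvPolynomial (Fin d) ℝ, DifferentiableAt ℝ (ev p) y := fun p =>
    (ev_contDiff p (n := 1)).differentiable (by norm_num) y
  induction p using MvPolynomial.induction_on with
  | C a =>
    have : ev (MvPolynomial.C a) = fun _ : Pt d => a := by ext; simp [ev]
    rw [this]; simp [ev]
  | add p q hp hq =>
    have : ev (p + q) = ev p + ev q := by ext; simp [ev]
    rw [this, fderiv_add (hdiff p) (hdiff q)]
    simp [hp, hq]; simp [ev]
  | mul_X p j hp =>
    have : ev (p * MvPolynomial.X j) = fun x => ev p x * (EuclideanSpace.proj j : Pt d →L[ℝ] ℝ) x := by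
      ext; simp [ev]
    rw [this, fderiv_fun_mul (hdiff p) (ContinuousLinearMap.differentiableAt _)]
    rw [ContinuousLinearMap.fderiv]
    simp [hp]
    simp [ev, ee, MvPolynomial.pderiv_X, Pi.single_apply, Derivation.leibniz]
    by_cases h : i = j
    · subst h; simp
    · simp [h, Ne.symm h]

/-- Algebraic Laplacian. -/
def LapP {d : ℕ} : MvPolynomial (Fin d) ℝ →ₗ[ℝ] MvPolynomial (Fin d) ℝ :=
  ∑ i, (MvPolynomial.pderiv i).toLinearMap ∘ₗ (MvPolynomial.pderiv i).toLinearMap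

lemma lapl_ev {d : ℕ} (p : MvPolynomial (Fin d) ℝ) (x : Pt d) : lapl (ev p) x = ev (LapP p) x := by
  unfold lapl
  have : ∀ i, (fun y => fderiv ℝ (ev p) y (ee i)) = ev (MvPolynomial.pderiv i p) := fun i => by
    ext y; exact ev_fderiv p y i
  simp_rw [this, ev_fderiv]
  simp [LapP, ev]

/-- The defining polynomial of a ball. -/
def rho {d : ℕ} (c : Pt d) (R : ℝ) : MvPolynomial (Fin d) ℝ :=
  MvPolynomial.C (R ^ 2) - ∑ i, (MvPolynomial.X i - MvPolynomial.C (c i)) ^ 2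

lemma ev_rho {d : ℕ} (c : Pt d) (R : ℝ) (x : Pt d) : ev (rho c R) x = R ^ 2 - ‖x - c‖ ^ 2 := by
  rw [EuclideanSpace.norm_sq_eq]
  simp [ev, rho]

lemma av_harm {d : ℕ} (hd : 2 ≤ d) {p : MvPolynomial (Fin d) ℝ} (hp : LapP p = 0) (x : Pt d) {r : ℝ}
    (hr : 0 < r) : av (ev p) x r = ev p x := by
  apply le_antisymm
  · exact av_le_of_lapl hd (ev_contDiff p (n := 2)) x hr fun y _ => by rw [lapl_ev, hp]; simp [ev]
  · have h : LapP (-p) = 0 := by rw [map_neg, hp, neg_zero]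
    have := av_le_of_lapl hd (ev_contDiff (-p) (n := 2)) x hr fun y _ => by
      rw [lapl_ev, h]; simp [ev]
    have e : ev (-p) = fun y => - ev p y := by ext; simp [ev]
    rw [e, av_neg] at this
    linarith

lemma bounds_harm {d : ℕ} (hd : 2 ≤ d) {p : MvPolynomial (Fin d) ℝ} (hp : LapP p = 0) {c : Pt d} {R : ℝ}
    (hR : 0 < R) {a : ℝ} (ha : ∀ x ∈ sphere c R, |ev p x| ≤ a) :
    ∀ x ∈ closedBall c R, |ev p x| ≤ a := by
  have hcont : ∀ q : MvPolynomial (Fin d) ℝ, Continuous (ev q) := fun q =>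
    (ev_contDiff q (n := 1)).continuous
  have hfr : frontier (ball c R) = sphere c R := frontier_ball c hR.ne'
  have low : ∀ q : MvPolynomial (Fin d) ℝ, LapP q = 0 → (∀ x ∈ sphere c R, -a ≤ ev q x) →
      ∀ x ∈ ball c R, -a ≤ ev q x := fun q hq hs =>
    min_principle hd isBounded_ball isOpen_ball (hcont q).continuousOn
      (fun x _ => by
        filter_upwards [self_mem_nhdsWithin] with r hr
        exact (av_harm hd hq x hr).le) (by rw [hfr]; exact hs)
  have e : ∀ x, ev (-p) x = - ev p x := by intro x; simp [ev]
  intro x hx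
  rcases (mem_closedBall.1 hx).lt_or_eq with h | h
  · rw [abs_le]
    refine ⟨low p hp (fun x hx => (abs_le.1 (ha x hx)).1) x h, ?_⟩
    have := low (-p) (by rw [map_neg, hp, neg_zero])
      (fun x hx => by rw [e]; linarith [(abs_le.1 (ha x hx)).2]) x h
    rw [e] at this; linarith
  · exact ha x h

lemma pderiv_mem {d : ℕ} {m : ℕ} (i : Fin d) {p : MvPolynomial (Fin d) ℝ}
    (hp : p.totalDegree ≤ m + 1) : (MvPolynomial.pderiv i p).totalDegree ≤ m := by
  rw [← MvPolynomial.mem_restrictTotalDegree]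
  rw [p.as_sum, map_sum]
  refine Submodule.sum_mem _ fun s hs => ?_
  rw [MvPolynomial.pderiv_monomial, MvPolynomial.mem_restrictTotalDegree]
  by_cases h : s i = 0
  · simp [h]
  · have h1 := (MvPolynomial.le_totalDegree hs).trans hp
    refine (MvPolynomial.totalDegree_monomial_le _ _).trans ?_
    have h2 : s = (s - Finsupp.single i 1) + Finsupp.single i 1 := by
      rw [tsub_add_cancel_of_le]
      simpa using Nat.one_le_iff_ne_zero.2 h
    rw [h2, Finsupp.sum_add_index' (by simp) (by simp)] at h1
    simp at h1
    exact h1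

lemma LapP_degree {d : ℕ} {m : ℕ} {p : MvPolynomial (Fin d) ℝ}
    (hp : p.totalDegree ≤ m + 2) : (LapP p).totalDegree ≤ m := by
  rw [← MvPolynomial.mem_restrictTotalDegree]
  unfold LapP
  rw [LinearMap.sum_apply]
  refine Submodule.sum_mem _ fun i _ => ?_
  rw [MvPolynomial.mem_restrictTotalDegree]
  exact pderiv_mem i (pderiv_mem i hp)

lemma rho_degree {d : ℕ} (c : Pt d) (R : ℝ) : (rho c R).totalDegree ≤ 2 := by
  unfold rho
  refine (MvPolynomial.totalDegree_sub _ _).trans (max_le (by rw [MvPolynomial.totalDegree_C]; omega) ?_)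
  refine MvPolynomial.totalDegree_finsetSum_le fun i _ => ?_
  refine (MvPolynomial.totalDegree_pow _ _).trans ?_
  have : (MvPolynomial.X i - MvPolynomial.C (c i) : MvPolynomial (Fin d) ℝ).totalDegree ≤ 1 :=
    (MvPolynomial.totalDegree_sub _ _).trans (max_le (by simp) (by simp))
  omega

lemma eq_zero_of_ball {d : ℕ} (p : MvPolynomial (Fin d) ℝ) {c : Pt d} {R : ℝ} (hR : 0 < R)
    (h : ∀ x ∈ ball c R, ev p x = 0) : p = 0 := by
  have ho : IsOpen ((WithLp.toLp 2 : (Fin d → ℝ) → Pt d) ⁻¹' ball c R) :=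
    isOpen_ball.preimage (PiLp.continuous_toLp 2 _)
  obtain ⟨s, hs, hsub⟩ := isOpen_pi_iff'.1 ho c.ofLp (by simpa using hR)
  refine MvPolynomial.funext_set s (fun i => infinite_of_mem_nhds (c i) ((hs i).1.mem_nhds (hs i).2))
    fun x hx => ?_
  have := h _ (hsub hx)
  simpa [ev] using this

lemma harm_poly {d : ℕ} (hd : 2 ≤ d) (P : MvPolynomial (Fin d) ℝ) (c : Pt d) {R : ℝ} (hR : 0 < R) :
    ∃ H : MvPolynomial (Fin d) ℝ, LapP H = 0 ∧ ∀ x ∈ sphere c R, ev H x = ev P x := by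
  set n := P.totalDegree
  have hdeg : ∀ p ∈ MvPolynomial.restrictTotalDegree (Fin d) ℝ n,
      (LapP ∘ₗ LinearMap.mulLeft ℝ (rho c R)) p ∈ MvPolynomial.restrictTotalDegree (Fin d) ℝ n := by
    intro p hp
    rw [MvPolynomial.mem_restrictTotalDegree] at hp ⊢
    simp only [LinearMap.coe_comp, Function.comp_apply, LinearMap.mulLeft_apply]
    apply LapP_degree
    have := MvPolynomial.totalDegree_mul (rho c R) p
    have := rho_degree c R
    omega
  set T := (LapP ∘ₗ LinearMap.mulLeft ℝ (rho c R)).restrict hdeg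
  have hinj : Function.Injective T := by
    rw [injective_iff_map_eq_zero]
    intro p hp
    have hp' : LapP (rho c R * p.1) = 0 := by
      have := congrArg Subtype.val hp
      simpa [T] using this
    have e : ∀ x, ev (rho c R * p.1) x = (R ^ 2 - ‖x - c‖ ^ 2) * ev p.1 x := by
      intro x; rw [← ev_rho]; simp [ev]
    have hz := bounds_harm hd hp' hR (a := 0) (fun x hx => by
      rw [e, mem_sphere_iff_norm.1 hx]; simp)
    apply Subtype.ext
    apply eq_zero_of_ball _ hR (c := c)
    intro x hx
    have h1 := hz x (ball_subset_closedBall hx)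
    rw [e] at h1
    have h2 := abs_nonpos_iff.1 h1
    have h3 : ‖x - c‖ < R := mem_ball_iff_norm.1 hx
    have h4 : (R ^ 2 - ‖x - c‖ ^ 2) ≠ 0 := by nlinarith [norm_nonneg (x - c)]
    exact (mul_eq_zero.1 h2).resolve_left h4
  have hsurj : Function.Surjective T := LinearMap.injective_iff_surjective.1 hinj
  obtain ⟨s, hs⟩ := hsurj ⟨-LapP P, by
    rw [MvPolynomial.mem_restrictTotalDegree, MvPolynomial.totalDegree_neg]
    exact LapP_degree (by omega)⟩
  refine ⟨P + rho c R * s.1, ?_, fun x hx => ?_⟩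
  · have := congrArg Subtype.val hs
    have h : LapP (rho c R * s.1) = - LapP P := by simpa [T] using this
    rw [map_add, h, add_neg_cancel]
  · have : ev (P + rho c R * s.1) x = ev P x + ev (rho c R) x * ev s.1 x := by simp [ev]
    rw [this, ev_rho, mem_sphere_iff_norm.1 hx]; simp




lemma ev_cont {d : ℕ} (p : MvPolynomial (Fin d) ℝ) : Continuous (ev p) :=
  (ev_contDiff p (n := 1)).continuous

lemma av_close {d : ℕ} {u v : Pt d → ℝ} (hu : Continuous u) (hv : Continuous v) {x : Pt d} {r : ℝ}
    (hr : 0 < r) {a : ℝ} (h : ∀ y ∈ ball x r, |u y - v y| ≤ a) : |av u x r - av v x r| ≤ a := by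
  have h1 : av u x r ≤ av (fun y => v y + a) x r :=
    av_mono (intOn_ball hu x r) (intOn_ball (by fun_prop) x r)
      fun y hy => by linarith [(abs_le.1 (h y hy)).2]
  have h2 : av v x r ≤ av (fun y => u y + a) x r :=
    av_mono (intOn_ball hv x r) (intOn_ball (by fun_prop) x r)
      fun y hy => by linarith [(abs_le.1 (h y hy)).1]
  rw [av_add_const hr (intOn_ball hv x r)] at h1
  rw [av_add_const hr (intOn_ball hu x r)] at h2
  rw [abs_le]; constructor <;> linarith

lemma poly_dense {d : ℕ} {f : Pt d → ℝ} (hf : Continuous f) (c : Pt d) (R : ℝ) {ε : ℝ}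
    (hε : 0 < ε) : ∃ P : MvPolynomial (Fin d) ℝ, ∀ x ∈ closedBall c R, |ev P x - f x| < ε := by
  let co : Fin d → C(Pt d, ℝ) := fun i => ⟨fun x => x i, by fun_prop⟩
  have hA : (MvPolynomial.aeval co : MvPolynomial (Fin d) ℝ →ₐ[ℝ] C(Pt d, ℝ)).range.SeparatesPoints := by
    intro x y hxy
    obtain ⟨i, hi⟩ : ∃ i, x i ≠ y i := by
      by_contra! hcon
      exact hxy (PiLp.ext hcon)
    refine ⟨co i, ⟨co i, ⟨MvPolynomial.X i, by simp⟩, rfl⟩, hi⟩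
  obtain ⟨g, ⟨P, hP⟩, hg⟩ :=
    ContinuousMap.exists_mem_subalgebra_near_continuous_of_isCompact_of_separatesPoints hA
      ⟨f, hf⟩ (isCompact_closedBall c R) hε
  refine ⟨P, fun x hx => ?_⟩
  have key : ∀ P : MvPolynomial (Fin d) ℝ, (MvPolynomial.aeval co P) x = ev P x := by
    intro P
    induction P using MvPolynomial.induction_on with
    | C a => simp [ev]
    | add p q hp hq => simp only [map_add, ContinuousMap.add_apply, hp, hq, ev]
    | mul_X p i hp =>
      simp only [map_mul, ContinuousMap.mul_apply, hp, ev, MvPolynomial.aeval_X, MvPolynomial.eval_X]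
      rfl
  have : g x = ev P x := by
    rw [← hP]; exact key P
  rw [← this]; exact hg x hx

lemma dirichlet {d : ℕ} (hd : 2 ≤ d) {f : Pt d → ℝ} (hf : Continuous f) (c : Pt d) {R : ℝ}
    (hR : 0 < R) : ∃ h : Pt d → ℝ, Continuous h ∧ (∀ x, x ∉ ball c R → h x = f x) ∧
      ∀ x r, 0 < r → ball x r ⊆ ball c R → av h x r = h x := by
  have hex : ∀ n : ℕ, ∃ H : MvPolynomial (Fin d) ℝ, LapP H = 0 ∧
      ∀ x ∈ sphere c R, |ev H x - f x| ≤ 1 / ((n : ℝ) + 1) := by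
    intro n
    obtain ⟨P, hP⟩ := poly_dense hf c R (ε := 1 / ((n : ℝ) + 1)) (by positivity)
    obtain ⟨H, hH, hHP⟩ := harm_poly hd P c hR
    exact ⟨H, hH, fun x hx => by rw [hHP x hx]; exact (hP x (sphere_subset_closedBall hx)).le⟩
  choose H hH hHf using hex
  have lim0 : Tendsto (fun n : ℕ => 1 / ((n : ℝ) + 1)) atTop (𝓝 0) :=
    tendsto_one_div_add_atTop_nhds_zero_nat
  have hC : ∀ n m, ∀ x ∈ closedBall c R,
      |ev (H n) x - ev (H m) x| ≤ 1 / ((n : ℝ) + 1) + 1 / ((m : ℝ) + 1) := by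
    intro n m x hx
    have e : ∀ x, ev (H n - H m) x = ev (H n) x - ev (H m) x := by intro x; simp [ev]
    rw [← e]
    refine bounds_harm hd (by rw [map_sub, hH, hH, sub_zero]) hR (fun y hy => ?_) x hx
    rw [e]
    have h1 := abs_le.1 (hHf n y hy)
    have h2 := abs_le.1 (hHf m y hy)
    rw [abs_le]; constructor <;> linarith
  have hlim : ∀ x, ∃ l, x ∈ closedBall c R → Tendsto (fun n => ev (H n) x) atTop (𝓝 l) := by
    intro x
    by_cases hx : x ∈ closedBall c R
    · have : CauchySeq (fun n => ev (H n) x) := by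
        rw [Metric.cauchySeq_iff']
        intro ε hε
        obtain ⟨N, hN⟩ := ((lim0.eventually (gt_mem_nhds (half_pos hε)))).exists_forall_of_atTop
        refine ⟨N, fun n hn => ?_⟩
        rw [Real.dist_eq]
        linarith [hC n N x hx, hN n hn, hN N le_rfl]
      obtain ⟨l, hl⟩ := cauchySeq_tendsto_of_complete this
      exact ⟨l, fun _ => hl⟩
    · exact ⟨0, fun h => absurd h hx⟩
  choose g hg using hlim
  have hgn : ∀ n, ∀ x ∈ closedBall c R, |ev (H n) x - g x| ≤ 1 / ((n : ℝ) + 1) := by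
    intro n x hx
    have h1 : Tendsto (fun m => |ev (H n) x - ev (H m) x|) atTop (𝓝 |ev (H n) x - g x|) :=
      (tendsto_const_nhds.sub (hg x hx)).abs
    have h2 := lim0.const_add (1 / ((n : ℝ) + 1))
    rw [add_zero] at h2
    exact le_of_tendsto_of_tendsto' h1 h2 fun m => hC n m x hx
  have hgc : ContinuousOn g (closedBall c R) := by
    have : TendstoUniformlyOn (fun n => ev (H n)) g atTop (closedBall c R) := by
      rw [Metric.tendstoUniformlyOn_iff]
      intro ε hε
      filter_upwards [lim0.eventually (gt_mem_nhds hε)] with n hn x hx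
      rw [dist_comm, Real.dist_eq]
      exact (hgn n x hx).trans_lt hn
    exact this.continuousOn (Eventually.of_forall fun n => (ev_cont (H n)).continuousOn).frequently
  have hgf : ∀ x ∈ sphere c R, g x = f x := by
    intro x hx
    have h1 := hg x (sphere_subset_closedBall hx)
    refine tendsto_nhds_unique h1 ?_
    rw [tendsto_iff_dist_tendsto_zero]
    exact squeeze_zero (fun _ => dist_nonneg) (fun n => by rw [Real.dist_eq]; exact hHf n x hx) lim0
  classical
  set h := (closedBall c R).piecewise g f with hh
  have hin : ∀ x ∈ closedBall c R, h x = g x := fun x hx => piecewise_eq_of_mem _ _ _ hx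
  have hcont : Continuous h := by
    refine continuous_piecewise ?_ ?_ hf.continuousOn
    · rw [frontier_closedBall c hR.ne']; exact hgf
    · rw [closure_closedBall]; exact hgc
  refine ⟨h, hcont, fun x hx => ?_, fun x r hr hsub => ?_⟩
  · by_cases hx' : x ∈ closedBall c R
    · rw [hin x hx']
      apply hgf
      simp at hx hx' ⊢
      exact le_antisymm hx' hx
    · exact piecewise_eq_of_notMem _ _ _ hx'
  · have hxb : x ∈ closedBall c R := ball_subset_closedBall (hsub (mem_ball_self hr))
    have key : ∀ n : ℕ, |av h x r - h x| ≤ 1 / ((n : ℝ) + 1) + 1 / ((n : ℝ) + 1) := by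
      intro n
      have h1 := av_close (ev_cont (H n)) hcont hr (x := x) (a := 1 / ((n : ℝ) + 1))
        fun y hy => by
          have := ball_subset_closedBall (hsub hy)
          rw [hin y this]; exact hgn n y this
      rw [av_harm hd (hH n) x hr] at h1
      have h2 := hgn n x hxb
      rw [← hin x hxb] at h2
      rw [abs_le] at h1 h2 ⊢
      constructor <;> linarith
    have h0 : |av h x r - h x| ≤ 0 := by
      have := lim0.add lim0
      rw [add_zero] at this
      exact ge_of_tendsto' this key
    linarith [abs_nonpos_iff.1 h0]




lemma phi_cont {d : ℕ} {u : Pt d → ℝ} (hu : Continuous u) (x : Pt d) : Continuous (phi u x) := by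
  have h := continuous_parametric_integral_of_continuous (μ := (volume : Measure (Pt d)))
    (f := fun (t : ℝ) (y : Pt d) => u (x + t • y)) (by unfold Function.uncurry; fun_prop)
    (isCompact_closedBall (0 : Pt d) 1)
  have e : phi u x = fun t => ∫ y in closedBall (0 : Pt d) 1, u (x + t • y) := by
    ext t
    unfold phi
    apply setIntegral_congr_set
    have hs : (sphere (0 : Pt d) 1 : Set (Pt d)) =ᵐ[volume] (∅ : Set (Pt d)) :=
      ae_eq_empty.2 (Measure.addHaar_sphere_of_ne_zero volume 0 one_ne_zero)
    rw [← ball_union_sphere]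
    exact (union_ae_eq_left_of_ae_eq_empty hs).symm
  rw [e]; exact h

lemma int_eq_av {d : ℕ} (u : Pt d → ℝ) (x : Pt d) {r : ℝ} (hr : 0 < r) :
    ∫ y in ball x r, u y = volume.real (ball x r) * av u x r := by
  rw [av_def, mul_inv_cancel_left₀ (volr_pos x hr).ne']

lemma small_ball {d : ℕ} {W : Set (Pt d)} (hW : IsOpen W) {x : Pt d} (hx : x ∈ W) :
    ∀ᶠ r in 𝓝[>] (0 : ℝ), 0 < r ∧ closedBall x r ⊆ W := by
  obtain ⟨R, hR, hRW⟩ := Metric.isOpen_iff.1 hW x hx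
  filter_upwards [Ioo_mem_nhdsGT hR] with r hr
  exact ⟨hr.1, (closedBall_subset_ball hr.2).trans hRW⟩

lemma below_dir {d : ℕ} (hd : 2 ≤ d) {u h : Pt d → ℝ} (hu : Continuous u) (hh : Continuous h)
    {c : Pt d} {R : ℝ} (hs : ∀ x ∈ ball c R, LSup u x)
    (ho : ∀ x, x ∉ ball c R → h x ≤ u x)
    (ha : ∀ x r, 0 < r → ball x r ⊆ ball c R → av h x r = h x) : ∀ x, h x ≤ u x := by
  intro x
  by_cases hx : x ∈ ball c R
  · have := min_principle hd isBounded_ball isOpen_ball (u := fun y => u y - h y) (c := 0)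
      (hu.sub hh).continuousOn (W := ball c R) ?_ ?_ x hx
    · linarith
    · intro y hy
      filter_upwards [hs y hy, small_ball isOpen_ball hy] with r h1 h2
      rw [av_sub (intOn_ball hu y r) (intOn_ball hh y r),
        ha y r h2.1 (ball_subset_closedBall.trans h2.2)]
      linarith
    · intro y hy
      rw [frontier, isOpen_ball.interior_eq] at hy
      linarith [ho y hy.2]
  · exact ho x hx

lemma glob {d : ℕ} (hd : 2 ≤ d) {u : Pt d → ℝ} (hu : Continuous u) {W : Set (Pt d)}
    (hs : ∀ x ∈ W, LSup u x) {x : Pt d} {r : ℝ} (hr : 0 < r)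
    (hsub : closedBall x r ⊆ W) : av u x r ≤ u x := by
  by_contra! hcon
  set ε := (av u x r - u x) / 2 with hε
  have hε0 : 0 < ε := by rw [hε]; linarith
  set G : ℝ → ℝ := fun t => t ^ d * (phi u x t - (u x + ε) * vb d) with hG
  have hGc : Continuous G := by
    have := phi_cont hu x
    fun_prop
  have hGt : ∀ t, 0 < t → G t = volume.real (ball x t) * (av u x t - (u x + ε)) := by
    intro t ht
    rw [hG, av_eq u x ht, vol_ball x ht]
    have := (vb_pos d).ne'
    field_simp
  obtain ⟨t0, ht0, hmax⟩ := isCompact_Icc.exists_isMaxOn (nonempty_Icc.2 hr.le) hGc.continuousOn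
  have hGr : 0 < G r := by
    rw [hGt r hr]
    refine mul_pos (volr_pos x hr) ?_
    rw [hε]; linarith
  have hG0 : G 0 = 0 := by
    simp only [hG]; rw [zero_pow (by omega), zero_mul]
  have ht0p : 0 < t0 := by
    rcases ht0.1.lt_or_eq with h | h
    · exact h
    · have := hmax (right_mem_Icc.2 hr.le)
      simp only [mem_setOf_eq] at this
      rw [← h, hG0] at this
      linarith
  obtain ⟨h, hh, hho, hha⟩ := dirichlet hd hu x ht0p
  have hle : ∀ y, h y ≤ u y := below_dir hd hu hh
    (fun y hy => hs y (hsub (closedBall_subset_closedBall ht0.2 (ball_subset_closedBall hy))))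
    (fun y hy => (hho y hy).le) hha
  set K := closedBall x t0 ∩ {y | ε / 2 ≤ u y - h y} with hK
  have hKc : IsClosed K := isClosed_closedBall.inter (isClosed_le continuous_const (hu.sub hh))
  have hKb : K ⊆ ball x t0 := by
    intro y hy
    by_contra hn
    have h1 := hho y hn
    have h2 : ε / 2 ≤ u y - h y := hy.2
    linarith
  obtain ⟨s, ⟨hs0, hst⟩, hKs⟩ := exists_pos_lt_subset_ball ht0p hKc hKb
  have hGst : G s ≤ G t0 := hmax ⟨hs0.le, hst.le.trans ht0.2⟩
  have hsubb : ball x s ⊆ ball x t0 := ball_subset_ball hst.le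
  have hi : ∀ t, IntegrableOn (fun y => u y - h y) (ball x t) := fun t => intOn_ball (hu.sub hh) x t
  have avu : ∀ t, 0 < t → t ≤ t0 →
      volume.real (ball x t) * av u x t = (∫ y in ball x t, (u y - h y)) + volume.real (ball x t) * h x := by
    intro t ht htt
    rw [int_eq_av _ _ ht, av_sub (intOn_ball hu x t) (intOn_ball hh x t),
      hha x t ht (ball_subset_ball htt)]
    ring
  have hvd : volume.real (ball x t0 \ ball x s) = volume.real (ball x t0) - volume.real (ball x s) :=
    measureReal_diff hsubb measurableSet_ball measure_ball_lt_top.ne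
  have hdiff : ∫ y in ball x t0 \ ball x s, (u y - h y) =
      (∫ y in ball x t0, (u y - h y)) - ∫ y in ball x s, (u y - h y) :=
    integral_diff measurableSet_ball (hi t0) hsubb
  have hdl : ∫ y in ball x t0 \ ball x s, (u y - h y) ≤
      ε / 2 * volume.real (ball x t0 \ ball x s) := by
    have h1 : ∫ y in ball x t0 \ ball x s, (u y - h y) ≤ ∫ y in ball x t0 \ ball x s, (ε / 2) := by
      refine setIntegral_mono_on ((hi t0).mono_set diff_subset)
        ((intOn_ball continuous_const x t0).mono_set diff_subset)
        (measurableSet_ball.diff measurableSet_ball) fun y hy => ?_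
      by_contra! hc
      exact hy.2 (hKs ⟨ball_subset_closedBall hy.1, hc.le⟩)
    refine h1.trans (le_of_eq ?_)
    rw [setIntegral_const, smul_eq_mul, mul_comm]
  rw [hGt s hs0, hGt t0 ht0p, mul_sub, mul_sub, avu s hs0 hst.le, avu t0 ht0p le_rfl] at hGst
  rw [hdiff, hvd] at hdl
  have hvlt : volume.real (ball x s) < volume.real (ball x t0) := by
    rw [vol_ball x hs0, vol_ball x ht0p]
    exact mul_lt_mul_of_pos_right (pow_lt_pow_left₀ hst hs0.le (by omega)) (vb_pos d)
  have hx := hle x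
  nlinarith [mul_pos (sub_pos.2 hvlt) hε0, mul_nonneg (sub_pos.2 hvlt).le (sub_nonneg.2 hx)]




/-- The Perron family attached to a continuous local supersolution `p` on `W`. -/
structure InPS {d : ℕ} (W : Set (Pt d)) (p : Pt d → ℝ) (u : Pt d → ℝ) : Prop where
  cont : Continuous u
  cpt : ∃ K, IsCompact K ∧ K ⊆ W ∧ ∀ x, x ∉ K → u x = p x
  le : ∀ x, u x ≤ p x
  sup : ∀ x ∈ W, LSup u x

lemma InPS.self {d : ℕ} {W : Set (Pt d)} {p : Pt d → ℝ} (hp : Continuous p)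
    (hs : ∀ x ∈ W, LSup p x) : InPS W p p :=
  ⟨hp, ⟨∅, isCompact_empty, empty_subset _, fun _ _ => rfl⟩, fun _ => le_rfl, hs⟩

lemma LSup.min {d : ℕ} {u v : Pt d → ℝ} (hu : Continuous u) (hv : Continuous v) {x : Pt d}
    (h1 : LSup u x) (h2 : LSup v x) : LSup (fun y => min (u y) (v y)) x := by
  filter_upwards [h1, h2] with r h1 h2
  have i := intOn_ball (hu.min hv) x r
  exact le_min ((av_mono i (intOn_ball hu x r) fun y _ => min_le_left _ _).trans h1)
    ((av_mono i (intOn_ball hv x r) fun y _ => min_le_right _ _).trans h2)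

lemma LSup.add_const {d : ℕ} {u : Pt d → ℝ} (hu : Continuous u) {x : Pt d} (h : LSup u x) (c : ℝ) :
    LSup (fun y => u y + c) x := by
  filter_upwards [h, self_mem_nhdsWithin] with r h1 hr
  rw [av_add_const hr (intOn_ball hu x r)]
  linarith

lemma InPS.min {d : ℕ} {W : Set (Pt d)} {p u v : Pt d → ℝ} (hu : InPS W p u) (hv : InPS W p v) :
    InPS W p (fun y => min (u y) (v y)) := by
  obtain ⟨K, hK, hKW, hKu⟩ := hu.cpt
  obtain ⟨L, hL, hLW, hLv⟩ := hv.cpt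
  refine ⟨hu.cont.min hv.cont, ⟨K ∪ L, hK.union hL, union_subset hKW hLW, fun x hx => ?_⟩,
    fun x => (min_le_left _ _).trans (hu.le x), fun x hx => (hu.sup x hx).min hu.cont hv.cont (hv.sup x hx)⟩
  rw [mem_union, not_or] at hx
  rw [hKu x hx.1, hLv x hx.2, min_self]

lemma InPS.off {d : ℕ} {W : Set (Pt d)} {p u : Pt d → ℝ} (hu : InPS W p u) {x : Pt d} (hx : x ∉ W) :
    u x = p x := by
  obtain ⟨K, hK, hKW, hKu⟩ := hu.cpt
  exact hKu x fun h => hx (hKW h)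

lemma InPS.lower {d : ℕ} (hd : 2 ≤ d) {W : Set (Pt d)} (hb : Bornology.IsBounded W) (hW : IsOpen W)
    {p u : Pt d → ℝ} (hu : InPS W p u) {m : ℝ} (hm : ∀ x ∈ closure W, m ≤ p x) :
    ∀ x ∈ W, m ≤ u x :=
  min_principle hd hb hW hu.cont.continuousOn hu.sup fun x hx => by
    rw [frontier, hW.interior_eq] at hx
    rw [hu.off hx.2]; exact hm x hx.1

lemma InPS.mod {d : ℕ} (hd : 2 ≤ d) {W : Set (Pt d)} {p u : Pt d → ℝ} (hu : InPS W p u)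
    {c : Pt d} {R : ℝ} (hR : 0 < R) (hsub : closedBall c R ⊆ W) :
    ∃ v, InPS W p v ∧ (∀ x, v x ≤ u x) ∧ av v c R = v c := by
  obtain ⟨v, hv, hvo, hva⟩ := dirichlet hd hu.cont c hR
  have hle : ∀ x, v x ≤ u x := below_dir hd hu.cont hv
    (fun x hx => hu.sup x (hsub (ball_subset_closedBall hx))) (fun x hx => (hvo x hx).le) hva
  obtain ⟨K, hK, hKW, hKu⟩ := hu.cpt
  refine ⟨v, ⟨hv, ⟨K ∪ closedBall c R, hK.union (isCompact_closedBall c R), union_subset hKW hsub,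
    fun x hx => ?_⟩, fun x => (hle x).trans (hu.le x), fun x hx => ?_⟩, hle, hva c R hR subset_rfl⟩
  · rw [mem_union, not_or] at hx
    rw [hvo x fun h => hx.2 (ball_subset_closedBall h), hKu x hx.1]
  · by_cases hxb : x ∈ ball c R
    · filter_upwards [small_ball isOpen_ball hxb] with r h
      exact (hva x r h.1 (ball_subset_closedBall.trans h.2)).le
    · filter_upwards [hu.sup x hx] with r h
      rw [hvo x hxb]
      exact (av_mono (intOn_ball hv x r) (intOn_ball hu.cont x r) fun y _ => hle y).trans h

lemma perron {d : ℕ} (hd : 2 ≤ d) {W : Set (Pt d)} (hb : Bornology.IsBounded W) (hW : IsOpen W)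
    {p : Pt d → ℝ} (hp : Continuous p) (hs : ∀ x ∈ W, LSup p x) :
    ∃ h : Pt d → ℝ, (∀ u, InPS W p u → ∀ x, h x ≤ u x) ∧
      (∀ x, ∀ ε > 0, ∃ u, InPS W p u ∧ u x < h x + ε) ∧ UpperSemicontinuous h ∧
      (∀ x r, 0 < r → closedBall x r ⊆ W → IntegrableOn h (ball x r) ∧ h x ≤ av h x r) ∧
      (∃ m, ∀ x ∈ W, m ≤ h x) := by
  obtain ⟨m, hm⟩ : ∃ m, ∀ x ∈ closure W, m ≤ p x := by
    obtain ⟨m, hm⟩ := (hb.isCompact_closure.image hp).bddBelow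
    exact ⟨m, fun x hx => hm (mem_image_of_mem p hx)⟩
  let S : Set C(Pt d, ℝ) := {u | InPS W p u}
  have hp' : (⟨p, hp⟩ : C(Pt d, ℝ)) ∈ S := InPS.self hp hs
  have : Nonempty S := ⟨⟨_, hp'⟩⟩
  let h : Pt d → ℝ := fun x => ⨅ u : S, u.1 x
  have hbd : ∀ x, BddBelow (range fun u : S => u.1 x) := by
    intro x
    by_cases hx : x ∈ W
    · exact ⟨m, by rintro _ ⟨u, rfl⟩; exact InPS.lower hd hb hW u.2 hm x hx⟩
    · exact ⟨p x, by rintro _ ⟨u, rfl⟩; exact (InPS.off u.2 hx).ge⟩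
  have hle : ∀ u, InPS W p u → ∀ x, h x ≤ u x := fun u hu x =>
    ciInf_le (hbd x) (⟨⟨u, hu.cont⟩, hu⟩ : S)
  have hap : ∀ x, ∀ ε > 0, ∃ u : S, u.1 x < h x + ε := fun x ε hε =>
    exists_lt_of_ciInf_lt (lt_add_of_pos_right _ hε)
  have hmh : ∀ x ∈ W, m ≤ h x := fun x hx => le_ciInf fun u => InPS.lower hd hb hW u.2 hm x hx
  have husc : UpperSemicontinuous h :=
    upperSemicontinuous_ciInf (fun x => hbd x) fun u => u.1.continuous.upperSemicontinuous
  -- a countable exhausting sequence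
  let w : ℕ → S := TopologicalSpace.denseSeq S
  have hw : ∀ x, ∀ ε > 0, ∃ n, (w n).1 x < h x + ε := by
    intro x ε hε
    obtain ⟨u, hu⟩ := hap x ε hε
    have ho : IsOpen {u : S | u.1 x < h x + ε} :=
      isOpen_lt ((continuous_eval_const x).comp continuous_subtype_val) continuous_const
    obtain ⟨n, hv1⟩ := (TopologicalSpace.denseRange_denseSeq S).exists_mem_open ho ⟨u, hu⟩
    exact ⟨n, hv1⟩
  let v : ℕ → Pt d → ℝ := fun n => Nat.rec (w 0).1 (fun k f => fun x => min (f x) ((w (k + 1)).1 x)) n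
  have hv0 : v 0 = (w 0).1 := rfl
  have hvs : ∀ n, v (n + 1) = fun x => min (v n x) ((w (n + 1)).1 x) := fun n => rfl
  have hvS : ∀ n, InPS W p (v n) := by
    intro n
    induction n with
    | zero => rw [hv0]; exact (w 0).2
    | succ k ih => rw [hvs]; exact ih.min (w (k + 1)).2
  have hvw : ∀ n x, v n x ≤ (w n).1 x := by
    intro n x
    cases n with
    | zero => exact le_rfl
    | succ k => rw [hvs]; exact min_le_right _ _
  have hva : ∀ x, Antitone fun n => v n x := fun x => antitone_nat_of_succ_le fun n => by
    rw [hvs]; exact min_le_left _ _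
  have hvt : ∀ x, Tendsto (fun n => v n x) atTop (𝓝 (h x)) := by
    intro x
    rw [Metric.tendsto_atTop]
    intro ε hε
    obtain ⟨N, hN⟩ := hw x ε hε
    refine ⟨N, fun n hn => ?_⟩
    have h1 := hle _ (hvS n) x
    have h2 : v n x ≤ v N x := hva x hn
    have h3 := hvw N x
    rw [Real.dist_eq, abs_lt]; constructor <;> linarith
  refine ⟨h, hle, fun x ε hε => ?_, husc, fun x r hr hsub => ?_, m, hmh⟩
  · obtain ⟨u, hu⟩ := hap x ε hε
    exact ⟨u.1, u.2, hu⟩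
  · have hbW : ball x r ⊆ W := ball_subset_closedBall.trans hsub
    have hbint : IntegrableOn (fun y => |m| + |p y|) (ball x r) :=
      intOn_ball (by fun_prop) x r
    have hhitg : IntegrableOn h (ball x r) := by
      refine Integrable.mono' hbint husc.measurable.aestronglyMeasurable ?_
      refine (ae_restrict_iff' measurableSet_ball).2 (Eventually.of_forall fun y hy => ?_)
      have h1 := hmh y (hbW hy)
      have h2 := hle p (InPS.self hp hs) y
      rw [Real.norm_eq_abs, abs_le]
      constructor <;> linarith [neg_abs_le m, le_abs_self (p y), abs_nonneg m, abs_nonneg (p y)]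
    refine ⟨hhitg, ?_⟩
    have hlim : Tendsto (fun n => ∫ y in ball x r, v n y) atTop (𝓝 (∫ y in ball x r, h y)) := by
      refine tendsto_integral_of_dominated_convergence (fun y => |m| + |p y|)
        (fun n => (hvS n).cont.aestronglyMeasurable) hbint (fun n => ?_)
        (Eventually.of_forall hvt)
      refine (ae_restrict_iff' measurableSet_ball).2 (Eventually.of_forall fun y hy => ?_)
      have h1 := InPS.lower hd hb hW (hvS n) hm y (hbW hy)
      have h2 := (hvS n).le y
      rw [Real.norm_eq_abs, abs_le]
      constructor <;> linarith [neg_abs_le m, le_abs_self (p y), abs_nonneg m, abs_nonneg (p y)]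
    have hlim2 := hlim.const_mul (volume.real (ball x r))⁻¹
    rw [← av_def] at hlim2
    refine ge_of_tendsto' hlim2 fun n => ?_
    rw [← av_def]
    obtain ⟨v', hv', hv'le, hv'a⟩ := (hvS n).mod hd hr hsub
    calc h x ≤ v' x := hle _ hv' x
      _ = av v' x r := hv'a.symm
      _ ≤ av (v n) x r := av_mono (intOn_ball hv'.cont x r) (intOn_ball (hvS n).cont x r)
        fun y _ => hv'le y




lemma hsol_le {d : ℕ} {W : Set (Pt d)} {f u : Pt d → ℝ} (hu : InUpperClass W f u) {z : Pt d}
    (hz : z ∈ W) (h0 : 0 ≤ u z) : HSol W f z ≤ u z := by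
  unfold HSol
  rw [if_pos hz]
  by_cases hb : BddBelow ((fun u : Pt d → ℝ => u z) '' {u | InUpperClass W f u})
  · exact csInf_le hb ⟨u, hu, rfl⟩
  · rw [Real.sInf_of_not_bddBelow hb]; exact h0

lemma upper_mk {d : ℕ} (hd : 2 ≤ d) {W W' : Set (Pt d)} (hWW : W' ⊆ W) {a h : Pt d → ℝ} {c : ℝ}
    (ha : Continuous a) (has : ∀ x ∈ W, LSup a x) (husc : UpperSemicontinuous h)
    (hmean : ∀ x r, 0 < r → closedBall x r ⊆ W → IntegrableOn h (ball x r) ∧ h x ≤ av h x r)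
    (h0 : ∀ x ∈ W, 0 ≤ a x - h x + c) {M : ℝ} (hM : ∀ x ∈ W, a x - h x + c ≤ M) {f : Pt d → ℝ}
    (hf : ∀ z ∈ frontier W', f z ≤ 0 ∨ (f z ≤ 1 ∧ ∀ᶠ y in 𝓝[W'] z, 1 ≤ a y - h y + c)) :
    InUpperClass W' f (fun x => a x - h x + c) := by
  refine ⟨⟨?_, ?_⟩, ?_, ?_, ?_⟩
  · have h1 : LowerSemicontinuous fun x => (a x + c) + (- h x) :=
      (ha.add continuous_const).lowerSemicontinuous.add
        (fun x y hy => by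
          filter_upwards [husc x (-y) (by linarith)] with z hz
          linarith)
    have e : (fun x => a x - h x + c) = fun x => (a x + c) + (- h x) := by ext; ring
    rw [e]; exact h1.lowerSemicontinuousOn _
  · intro x hx r hr hsub
    change av (fun x => a x - h x + c) x r ≤ _
    obtain ⟨hi, hle⟩ := hmean x r hr (hsub.trans hWW)
    have ia := intOn_ball ha x r
    rw [av_add_const (u := fun y => a y - h y) hr (ia.sub hi) c, av_sub ia hi]
    linarith [glob hd ha has hr (hsub.trans hWW)]
  · exact ⟨0, by rintro _ ⟨x, hx, rfl⟩; exact h0 x (hWW hx)⟩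
  · intro z hz
    have hne : (𝓝[W'] z).NeBot := mem_closure_iff_nhdsWithin_neBot.1 hz.1
    have hcob : (𝓝[W'] z).IsCoboundedUnder (· ≥ ·) (fun x => a x - h x + c) := by
      apply IsBoundedUnder.isCoboundedUnder_ge
      refine ⟨M, ?_⟩
      rw [eventually_map]
      filter_upwards [self_mem_nhdsWithin] with y hy using hM y (hWW hy)
    rcases hf z hz with h1 | ⟨h1, h2⟩
    · refine h1.trans (le_liminf_of_le hcob ?_)
      filter_upwards [self_mem_nhdsWithin] with y hy using h0 y (hWW hy)
    · exact h1.trans (le_liminf_of_le hcob h2)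
  · intro ε hε
    exact ⟨∅, isCompact_empty, fun y hy _ => by linarith [h0 y (hWW hy)]⟩

lemma lapl_cont {d : ℕ} {f : Pt d → ℝ} (hf : ContDiff ℝ 2 f) : Continuous (lapl f) := by
  unfold lapl
  refine continuous_finset_sum _ fun i _ => ?_
  exact ((contDiff_part hf (ee i)).continuous_fderiv (by norm_num)).clm_apply continuous_const

lemma lapl_add {d : ℕ} {f g : Pt d → ℝ} (hf : ContDiff ℝ 2 f) (hg : ContDiff ℝ 2 g) (x : Pt d) :
    lapl (fun y => f y + g y) x = lapl f x + lapl g x := by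
  unfold lapl
  rw [← Finset.sum_add_distrib]
  refine Finset.sum_congr rfl fun i _ => ?_
  have e : (fun y => fderiv ℝ (fun y => f y + g y) y (ee i)) =
      fun y => fderiv ℝ f y (ee i) + fderiv ℝ g y (ee i) := by
    ext y
    rw [fderiv_fun_add (hf.differentiable (by norm_num) y) (hg.differentiable (by norm_num) y)]
    rfl
  rw [e, fderiv_fun_add ((contDiff_part hf (ee i)).differentiable (by norm_num) x)
    ((contDiff_part hg (ee i)).differentiable (by norm_num) x)]
  rfl

lemma LSup_of_lapl {d : ℕ} (hd : 2 ≤ d) {W : Set (Pt d)} (hW : IsOpen W) {g : Pt d → ℝ}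
    (hg : ContDiff ℝ 2 g) (hl : ∀ x ∈ W, lapl g x ≤ 0) : ∀ x ∈ W, LSup g x := by
  intro x hx
  filter_upwards [small_ball hW hx] with r hr
  exact av_le_of_lapl hd hg x hr.1 fun y hy => hl y (hr.2 (ball_subset_closedBall hy))

lemma exists_q {d : ℕ} (hd : 2 ≤ d) (k : ℝ) :
    ∃ q : Pt d → ℝ, ContDiff ℝ 2 q ∧ ∀ x, lapl q x = - k := by
  let i0 : Fin d := ⟨0, by omega⟩
  let Q : MvPolynomial (Fin d) ℝ := MvPolynomial.C (-k / 2) * MvPolynomial.X i0 ^ 2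
  refine ⟨ev Q, ev_contDiff Q (n := 2), fun x => ?_⟩
  rw [lapl_ev]
  have : LapP Q = MvPolynomial.C (-k) := by
    unfold LapP
    rw [LinearMap.sum_apply, Finset.sum_eq_single i0]
    · simp [Q, Derivation.leibniz, MvPolynomial.pderiv_X]
      have h2 : (2 : MvPolynomial (Fin d) ℝ) = MvPolynomial.C 2 :=
        (map_ofNat MvPolynomial.C 2).symm
      rw [h2, MvPolynomial.pderiv_C, mul_zero, add_zero, ← map_mul, ← map_neg]
      congr 1; ring
    · intro j _ hj
      simp [Q, Derivation.leibniz, MvPolynomial.pderiv_X, Ne.symm hj, hj]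
    · simp
  rw [this]; simp [ev]

lemma exists_cut {d : ℕ} {V E : Set (Pt d)} (hV : IsOpen V) (hE : IsClosed E) (h : E ⊆ V) :
    ∃ f : Pt d → ℝ, ContDiff ℝ 2 f ∧ (∀ z, z ∉ V → ∀ᶠ y in 𝓝 z, f y = 0) ∧
      (∀ z ∈ E, ∀ᶠ y in 𝓝 z, f y = 1) ∧ ∀ x, 0 ≤ f x ∧ f x ≤ 1 := by
  obtain ⟨f, h0, h1, hf⟩ := exists_contMDiffMap_zero_one_nhds_of_isClosed (n := 2) (𝓘(ℝ, Pt d))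
    hV.isClosed_compl hE (disjoint_left.2 fun x hx hE => hx (h hE))
  refine ⟨f, contMDiff_iff_contDiff.1 f.contMDiff, fun z hz => ?_, fun z hz => ?_, fun x => hf x⟩
  · exact h0.filter_mono (nhds_le_nhdsSet hz)
  · exact h1.filter_mono (nhds_le_nhdsSet hz)

lemma main_aux {d : ℕ} (hd : 2 ≤ d) {V A E : Set (Pt d)} (hVo : IsOpen V)
    (hVb : Bornology.IsBounded V) (hE : IsClosed E) (hEA : E ⊆ A) (hEV : E ⊆ V)
    {z : Pt d} (hz : z ∈ V \ A) :
    HSol (V \ A) ((frontier V).indicator 1) z ≤ 1 - HSol (V \ E) (E.indicator 1) z := by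
  set W := V \ E with hWdef
  have hWo : IsOpen W := hVo.sdiff hE
  have hWb : Bornology.IsBounded W := hVb.subset (fun x hx => hx.1)
  have hAW : V \ A ⊆ W := fun x hx => ⟨hx.1, fun h => hx.2 (hEA h)⟩
  have hzW : z ∈ W := hAW hz
  obtain ⟨f, hf, hf0, hf1, hfI⟩ := exists_cut hVo hE hEV
  obtain ⟨M, hM⟩ := (hVb.isCompact_closure.image (lapl_cont hf)).bddAbove
  obtain ⟨q, hq, hql⟩ := exists_q hd (|M|)
  set p : Pt d → ℝ := fun x => f x + q x with hp
  have hpc : Continuous p := hf.continuous.add hq.continuous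
  have hqs : ∀ x ∈ W, LSup q x := LSup_of_lapl hd hWo hq fun x _ => by
    rw [hql]; linarith [abs_nonneg M]
  have hps : ∀ x ∈ W, LSup p x := LSup_of_lapl hd hWo (hf.add hq) fun x hx => by
    have h1 := lapl_add hf hq x
    have h2 : lapl f x ≤ M := hM (mem_image_of_mem _ (subset_closure hx.1))
    have h3 := hql x
    have h4 := le_abs_self M
    change lapl (fun y => f y + q y) x ≤ 0
    linarith
  obtain ⟨hp', hp1, hp2, hp3, hp4, ⟨mp, hmp⟩⟩ := perron hd hWb hWo hpc hps
  obtain ⟨hq', hq1, hq2, hq3, hq4, ⟨mq, hmq⟩⟩ := perron hd hWb hWo hq.continuous hqs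
  obtain ⟨Mp, hMp⟩ := (hWb.isCompact_closure.image hpc).bddAbove
  obtain ⟨Mq, hMq⟩ := (hWb.isCompact_closure.image hq.continuous).bddAbove
  refine le_of_forall_pos_le_add fun ε hε => ?_
  obtain ⟨p1, hpS, hpz⟩ := hp2 z (ε / 2) (half_pos hε)
  obtain ⟨q1, hqS, hqz⟩ := hq2 z (ε / 2) (half_pos hε)
  -- the two comparison functions
  have hmin1 : InPS W q (fun y => min (p1 y) (q y)) := by
    obtain ⟨K, hK, hKW, hKu⟩ := hpS.cpt
    refine ⟨hpS.cont.min hq.continuous, ⟨K, hK, hKW, fun x hx => ?_⟩, fun x => min_le_right _ _,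
      fun x hx => (hpS.sup x hx).min hpS.cont hq.continuous (hqs x hx)⟩
    rw [hKu x hx]
    exact min_eq_right (by simp only [hp]; linarith [(hfI x).1])
  have hmin2 : InPS W p (fun y => min (q1 y + 1) (p y)) := by
    obtain ⟨K, hK, hKW, hKu⟩ := hqS.cpt
    refine ⟨(hqS.cont.add continuous_const).min hpc, ⟨K, hK, hKW, fun x hx => ?_⟩,
      fun x => min_le_right _ _,
      fun x hx => ((hqS.sup x hx).add_const hqS.cont 1).min (hqS.cont.add continuous_const) hpc
        (hps x hx)⟩
    rw [hKu x hx]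
    exact min_eq_right (by simp only [hp]; linarith [(hfI x).2])
  have h20 : ∀ x ∈ W, 0 ≤ p1 x - hq' x + 0 := fun x _ => by
    have := (hq1 _ hmin1 x).trans (min_le_left _ _)
    linarith
  have h10 : ∀ x ∈ W, 0 ≤ q1 x - hp' x + 1 := fun x _ => by
    have := (hp1 _ hmin2 x).trans (min_le_left _ _)
    linarith
  have U2 : InUpperClass (V \ E) (E.indicator 1) (fun x => p1 x - hq' x + 0) := by
    refine upper_mk hd (W := W) subset_rfl hpS.cont hpS.sup hq3 hq4 h20 (M := Mp - mq)
      (fun x hx => ?_) fun y hy => ?_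
    · have h1 : p x ≤ Mp := hMp (mem_image_of_mem _ (subset_closure hx))
      linarith [hpS.le x, hmq x hx]
    · by_cases hyE : y ∈ E
      · right
        refine ⟨by simp [hyE], ?_⟩
        obtain ⟨K, hK, hKW, hKu⟩ := hpS.cpt
        have hyK : y ∉ K := fun h => (hKW h).2 hyE
        filter_upwards [nhdsWithin_le_nhds (hf1 y hyE),
          nhdsWithin_le_nhds (hK.isClosed.isOpen_compl.mem_nhds hyK)] with x hx1 hx2
        have h1 := hKu x hx2
        have h2 := hq1 q (InPS.self hq.continuous hqs) x
        simp only [hp] at h1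
        linarith
      · left; simp [hyE]
  have U1 : InUpperClass (V \ A) ((frontier V).indicator 1) (fun x => q1 x - hp' x + 1) := by
    refine upper_mk hd (W := W) hAW hqS.cont hqS.sup hp3 hp4 h10 (M := Mq - mp + 1)
      (fun x hx => ?_) fun y hy => ?_
    · have h1 : q x ≤ Mq := hMq (mem_image_of_mem _ (subset_closure hx))
      linarith [hqS.le x, hmp x hx]
    · by_cases hyV : y ∈ frontier V
      · right
        refine ⟨by simp [hyV], ?_⟩
        have hyV' : y ∉ V := by
          rw [frontier, hVo.interior_eq] at hyV; exact hyV.2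
        obtain ⟨K, hK, hKW, hKu⟩ := hqS.cpt
        have hyK : y ∉ K := fun h => hyV' (hKW h).1
        filter_upwards [nhdsWithin_le_nhds (hf0 y hyV'),
          nhdsWithin_le_nhds (hK.isClosed.isOpen_compl.mem_nhds hyK)] with x hx1 hx2
        have h1 := hKu x hx2
        have h2 := hp1 p (InPS.self hpc hps) x
        simp only [hp] at h2
        linarith
      · left; simp [hyV]
  have r1 := hsol_le U1 hz (h10 z hzW)
  have r2 := hsol_le U2 hzW (h20 z hzW)
  linarith



end

end HelperPWB

theorem stmt5 (d : ℕ) (hd : 2 ≤ d) (U : Set (Pt d)) (hUo : IsOpen U) (hUc : IsConnected U)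
    (A : Set (Pt d)) (hAU : A ⊆ U) (hAcl : closure A ∩ U ⊆ A)
    (V : Set (Pt d)) (hVo : IsOpen V) (hVb : Bornology.IsBounded V) (hVU : V ⊆ U)
    (E : Set (Pt d)) (hE : IsClosed E) (hEAV : E ⊆ A ∩ V) :
    ∀ z ∈ V \ A,
      HSol (V \ A) ((frontier V).indicator 1) z ≤ 1 - HSol (V \ E) (E.indicator 1) z := by
  intro z hz
  exact HelperPWB.main_aux hd hVo hVb hE (fun x hx => (hEAV hx).1) (fun x hx => (hEAV hx).2) hz
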